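/- Let a₁ ∈ O_D be a pure quaternion with ‖N(a₁)‖ ≥ 1/2, let t ≥ 1 be a natural number, and suppose r₀ ∈ O_D satisfies the k-star conditions for (a₁, t), with ‖N(1 − r₀)‖ ≥ 1/4, and such that z₀ = a₁ − r₀·a₁·(star r₀) satisfies ‖N(z₀)‖ > 2^(−2(t+4))·‖N(a₁)‖. Then every α ∈ O_D with r₀ − α ∈ 2^(t+6)·O_D (i.e., r₀ = α + 2^(t+6)·β for some β ∈ O_D) also satisfies the k-star conditions for (a₁, t). (This is the content of the reduction theorem asserting that the existence of r ∈ O_D satisfying the k-star conditions can be detected among representatives of O_D modulo π^u·O_D with u = t + 6e.) -/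

import Mathlib

open Quaternion

noncomputable section

/-- `D` is the quaternion algebra `ℍ[ℚ₂, 2, 5]` with `i² = 2`, `j² = 5`, `i·j = -j·i`;
this is the unique quaternion division algebra over `ℚ₂`. -/
abbrev D : Type := ℍ[ℚ_[2], 2, 5]

/-- The basis quaternion `i`. -/
def qi : D := ⟨0, 1, 0, 0⟩

/-- The basis quaternion `j`. -/
def qj : D := ⟨0, 0, 1, 0⟩

/-- `ω = (1 + j)/2`. -/
def qω : D := ⟨1/2, 0, 1/2, 0⟩

/-- The reduced norm `N(q) = q · (star q)` (as a scalar). -/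
def qN (q : D) : ℚ_[2] := (q * star q).re

/-- The reduced trace `T(q) = q + star q = 2·q.re` (as a scalar). -/
def qT (q : D) : ℚ_[2] := 2 * q.re

/-- `r` satisfies the k-star conditions for `(a₁, t)`: with `z = a₁ - r·a₁·(star r)`,
(i) `N(1-r)` is not represented by `x² + N(a₁)·y²` over `ℚ₂` (Hilbert symbol `-1`),
(ii) `N(z)·N(a₁)` is a nonzero square, and (iii) `‖N(z)‖ ≤ 2^(-2t)·‖N(a₁)‖`. -/
def kStar (a₁ : D) (t : ℕ) (r : D) : Prop :=
  (¬ ∃ x y : ℚ_[2], qN (1 - r) = x ^ 2 + qN a₁ * y ^ 2) ∧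
  (∃ c : ℚ_[2], c ≠ 0 ∧ qN (a₁ - r * a₁ * star r) * qN a₁ = c ^ 2) ∧
  ‖qN (a₁ - r * a₁ * star r)‖ ≤ (2 : ℝ) ^ (-(2 * (t : ℤ))) * ‖qN a₁‖

theorem qN_eq (q : D) : qN q = q.re ^ 2 - 2 * q.imI ^ 2 - 5 * q.imJ ^ 2 + 10 * q.imK ^ 2 := by
  simp [qN]; ring

theorem qN_mul (x y : D) : qN (x * y) = qN x * qN y := by
  simp only [qN_eq, QuaternionAlgebra.re_mul, QuaternionAlgebra.imI_mul,
    QuaternionAlgebra.imJ_mul, QuaternionAlgebra.imK_mul]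
  ring

theorem qN_star (x : D) : qN (star x) = qN x := by
  simp [qN_eq]

theorem qN_neg (x : D) : qN (-x) = qN x := by
  simp [qN_eq]

theorem qN_add (x y : D) : qN (x + y) = qN x + qN y + 2 * (x * star y).re := by
  simp [qN_eq]; ring

theorem norm_two : ‖(2 : ℚ_[2])‖ = 1 / 2 := by
  have := Padic.norm_p (p := 2)
  norm_num at this ⊢
  exact this

theorem sq_lemma (e : ℚ_[2]) (he : ‖e‖ < 1 / 4) : ∃ w : ℚ_[2], 1 + e = w ^ 2 ∧ ‖w‖ = 1 := by
  have he1 : ‖e‖ ≤ 1 := by linarith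
  let e' : ℤ_[2] := ⟨e, he1⟩
  have he' : ‖e'‖ < 1 / 4 := he
  have h2 : ‖(2 : ℤ_[2])‖ = 1 / 2 := by
    rw [PadicInt.norm_def]; exact norm_two
  obtain ⟨z, hz, -⟩ := hensels_lemma (p := 2) (R := ℤ_[2])
    (F := (Polynomial.X ^ 2 - Polynomial.C (1 + e') : Polynomial ℤ_[2])) (a := 1) (by
      have h11 : (1 + 1 : ℤ_[2]) = 2 := by norm_num
      simp [h11, h2]
      linarith)
  have hz' : z ^ 2 = 1 + e' := by
    simpa [sub_eq_zero] using hz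
  have hw : (1 + e) = (z : ℚ_[2]) ^ 2 := by
    have := congrArg (fun u : ℤ_[2] => (u : ℚ_[2])) hz'
    rw [PadicInt.coe_pow, PadicInt.coe_add, PadicInt.coe_one] at this
    exact this.symm
  refine ⟨z, hw, ?_⟩
  have hn : ‖(1 + e : ℚ_[2])‖ = 1 := by
    rw [Padic.add_eq_max_of_ne]
    · simp [he1]
    · simp; intro h; linarith
  rw [hw, norm_pow] at hn
  exact (pow_eq_one_iff_of_nonneg (norm_nonneg _) two_ne_zero).1 hn

theorem norm_pow2 (x : ℚ_[2]) (hx : x ≠ 0) : ∃ n : ℤ, ‖x‖ = (2 : ℝ) ^ n := by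
  obtain ⟨n, hn⟩ := Padic.padicNormE.image (p := 2) hx
  refine ⟨-n, ?_⟩
  rw [hn]; push_cast; rfl

theorem even_or_odd2 (u : ℤ_[2]) : ∃ v : ℤ_[2], u = 2 * v ∨ u = 1 + 2 * v := by
  obtain ⟨n, hn, h⟩ := PadicInt.exists_mem_range (p := 2) u
  rw [PadicInt.maximalIdeal_eq_span_p, Ideal.mem_span_singleton] at h
  obtain ⟨v, hv⟩ := h
  refine ⟨v, ?_⟩
  interval_cases n
  · left; simpa using hv
  · right
    push_cast at hv
    linear_combination hv

theorem norm_two_mul_lt (v : ℤ_[2]) : ‖2 * v‖ < 1 := by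
  have := (PadicInt.norm_lt_one_iff_dvd (p := 2) (2 * v)).2 ⟨v, by push_cast; rfl⟩
  exact this

theorem norm_odd (v : ℤ_[2]) : ‖1 + 2 * v‖ = 1 := by
  have h := norm_two_mul_lt v
  rw [PadicInt.norm_add_eq_max_of_ne]
  · rw [norm_one, max_eq_left h.le]
  · rw [norm_one]; exact h.ne'

theorem unit_lemma (u : ℤ_[2]) (hu : ‖u‖ = 1) : ‖u ^ 2 - 5‖ = 1 / 4 := by
  have h2 : ‖(2 : ℤ_[2])‖ = 1 / 2 := by
    rw [PadicInt.norm_def]; exact norm_two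
  obtain ⟨v, rfl | rfl⟩ := even_or_odd2 u
  · exact absurd hu (norm_two_mul_lt v).ne
  · have key : ∃ m : ℤ_[2], v ^ 2 + v - 1 = 1 + 2 * m := by
      obtain ⟨m, rfl | rfl⟩ := even_or_odd2 v
      · exact ⟨2 * m ^ 2 + m - 1, by ring⟩
      · exact ⟨2 * m ^ 2 + 3 * m, by ring⟩
    obtain ⟨m, hm⟩ := key
    have : (1 + 2 * v) ^ 2 - 5 = 2 * 2 * (1 + 2 * m) := by rw [← hm]; ring
    rw [this, norm_mul, norm_odd, norm_mul, h2]; norm_num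

theorem norm_form (a c : ℚ_[2]) : ∃ e : ℚ_[2], ‖a ^ 2 - 5 * c ^ 2‖ = ‖e‖ ^ 2 ∧
    (e = 0 → a = 0 ∧ c = 0) := by
  have h5 : ‖(5 : ℚ_[2])‖ = 1 := by
    have := (Padic.norm_natCast_eq_one_iff (p := 2) (n := 5)).2 (by norm_num)
    simpa using this
  by_cases hne : ‖a‖ = ‖c‖
  · by_cases hc : c = 0
    · subst hc
      have : a = 0 := by simpa using hne
      exact ⟨0, by simp [this], fun _ => ⟨this, rfl⟩⟩
    have hc' : ‖c‖ ≠ 0 := by simpa using hc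
    have hu : ‖a / c‖ = 1 := by rw [norm_div, hne, div_self hc']
    obtain ⟨u, hu'⟩ : ∃ u : ℤ_[2], (u : ℚ_[2]) = a / c := ⟨⟨a / c, hu.le⟩, rfl⟩
    have h := unit_lemma u (by rw [PadicInt.norm_def, hu', hu])
    have h' : ‖(a / c) ^ 2 - 5‖ = 1 / 4 := by
      rw [PadicInt.norm_def, PadicInt.coe_sub, PadicInt.coe_pow, hu'] at h
      exact h
    refine ⟨2 * c, ?_, fun h0 => ?_⟩
    · have : a ^ 2 - 5 * c ^ 2 = ((a / c) ^ 2 - 5) * c ^ 2 := by field_simp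
      rw [this, norm_mul, h', norm_mul, norm_two, norm_pow]; ring
    · simp [hc] at h0
  · have h1 : ‖a ^ 2‖ ≠ ‖-(5 * c ^ 2)‖ := by
      rw [norm_neg, norm_mul, h5, norm_pow, norm_pow, one_mul]
      intro h
      exact hne ((pow_left_inj₀ (norm_nonneg _) (norm_nonneg _) two_ne_zero).1 h)
    have h2 : ‖a ^ 2 - 5 * c ^ 2‖ = max (‖a‖ ^ 2) (‖c‖ ^ 2) := by
      rw [sub_eq_add_neg, Padic.add_eq_max_of_ne h1, norm_neg, norm_mul, h5, norm_pow,
        norm_pow, one_mul]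
    rcases lt_or_gt_of_ne hne with h | h
    · refine ⟨c, ?_, fun h0 => ?_⟩
      · rw [h2, max_eq_right]; gcongr
      · subst h0; simp at h; exact absurd h (not_lt.2 (norm_nonneg _))
    · refine ⟨a, ?_, fun h0 => ?_⟩
      · rw [h2, max_eq_left]; gcongr
      · subst h0; simp at h; exact absurd h (not_lt.2 (norm_nonneg _))

theorem aniso (a b c d : ℚ_[2]) (h : a ^ 2 - 2 * b ^ 2 - 5 * c ^ 2 + 10 * d ^ 2 = 0) :
    a = 0 ∧ b = 0 ∧ c = 0 ∧ d = 0 := by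
  obtain ⟨e, he, he0⟩ := norm_form a c
  obtain ⟨f, hf, hf0⟩ := norm_form b d
  have h1 : a ^ 2 - 5 * c ^ 2 = 2 * (b ^ 2 - 5 * d ^ 2) := by linear_combination h
  rw [h1, norm_mul, norm_two, hf] at he
  by_cases hee : e = 0
  · have hff : f = 0 := by simpa [hee] using he
    exact ⟨(he0 hee).1, (hf0 hff).1, (he0 hee).2, (hf0 hff).2⟩
  · exfalso
    have hff : f ≠ 0 := by
      rintro rfl
      simp at he
      exact hee (by simpa using he.symm)
    obtain ⟨m, hm⟩ := norm_pow2 e hee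
    obtain ⟨n, hn⟩ := norm_pow2 f hff
    rw [hm, hn] at he
    have h3 : (2 : ℝ) ^ (2 * n - 1) = (2 : ℝ) ^ (2 * m) := by
      rw [zpow_sub₀ two_ne_zero, mul_comm 2 n, mul_comm 2 m, zpow_mul, zpow_mul]
      have e1 : ((2 : ℝ) ^ n) ^ (2 : ℤ) = ((2 : ℝ) ^ n) ^ 2 := by norm_cast
      have e2 : ((2 : ℝ) ^ m) ^ (2 : ℤ) = ((2 : ℝ) ^ m) ^ 2 := by norm_cast
      rw [e1, e2, ← he, zpow_one]; ring
    have := zpow_right_injective₀ (by norm_num : (0 : ℝ) < 2) (by norm_num) h3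
    omega

theorem trace_le (q : D) : ‖2 * q.re‖ ^ 2 ≤ ‖qN q‖ := by
  by_contra hlt
  push Not at hlt
  set T := 2 * q.re with hT
  have hT0 : T ≠ 0 := by
    intro h0
    rw [h0] at hlt; simp at hlt
    exact absurd hlt (not_lt.2 (norm_nonneg _))
  have hTn : 0 < ‖T‖ ^ 2 := by positivity
  have h4 : ‖(4 : ℚ_[2])‖ = 1 / 4 := by
    rw [show (4 : ℚ_[2]) = 2 * 2 by norm_num, norm_mul, norm_two]; norm_num
  obtain ⟨w, hw, hw1⟩ := sq_lemma (-(4 * qN q / T ^ 2)) (by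
    rw [norm_neg, norm_div, norm_mul, norm_pow, h4, div_lt_iff₀ hTn]
    linarith)
  have h5 : T ^ 2 - 4 * qN q = (T * w) ^ 2 := by
    rw [mul_pow T, ← hw, mul_add, mul_neg, mul_div_cancel₀ _ (pow_ne_zero 2 hT0)]; ring
  rw [qN_eq] at h5
  have h6 := aniso (T * w / 2) q.imI q.imJ q.imK (by
    rw [hT] at h5 ⊢
    linear_combination (-1 / 4) * h5)
  have h7 := h6.1
  have hw0 : w ≠ 0 := by rintro rfl; simp at hw1
  simp [hT0, hw0] at h7

theorem cross_le (x y : D) : ‖2 * (x * star y).re‖ ^ 2 ≤ ‖qN x‖ * ‖qN y‖ := by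
  have := trace_le (x * star y)
  rwa [qN_mul, qN_star, norm_mul (qN x)] at this

theorem qN_add_le (x y : D) (C : ℝ) (hx : ‖qN x‖ ≤ C) (hy : ‖qN y‖ ≤ C) :
    ‖qN (x + y)‖ ≤ C := by
  have hC : 0 ≤ C := (norm_nonneg _).trans hx
  have h := cross_le x y
  have h' : ‖2 * (x * star y).re‖ ≤ C := by
    apply le_of_sq_le_sq _ hC
    calc _ ≤ _ := h
      _ ≤ C * C := by gcongr
      _ = C ^ 2 := by ring
  rw [qN_add]
  refine (Padic.nonarchimedean _ _).trans (max_le ?_ h')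
  exact (Padic.nonarchimedean _ _).trans (max_le hx hy)

theorem perturb (x y : D) (h : ‖qN y‖ * 16 < ‖qN x‖) :
    ∃ w : ℚ_[2], qN (x + y) = qN x * w ^ 2 ∧ ‖w‖ = 1 := by
  have hx : 0 < ‖qN x‖ := lt_of_le_of_lt (by positivity) h
  have hx0 : qN x ≠ 0 := norm_pos_iff.1 hx
  have hc := cross_le x y
  have hc' : ‖2 * (x * star y).re‖ < ‖qN x‖ / 4 := by
    apply lt_of_pow_lt_pow_left₀ 2 (by positivity)
    nlinarith
  obtain ⟨w, hw, hw1⟩ := sq_lemma ((qN y + 2 * (x * star y).re) / qN x) (by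
    rw [norm_div, div_lt_iff₀ hx]
    refine (Padic.nonarchimedean _ _).trans_lt (max_lt ?_ ?_) <;> linarith)
  refine ⟨w, ?_, hw1⟩
  rw [qN_add, ← hw]
  field_simp
  ring

theorem qN_two_pow (n : ℕ) : ‖qN ((2 : D) ^ n)‖ = (1 / 4) ^ n := by
  induction n with
  | zero => simp [qN_eq]
  | succ k ih =>
    rw [pow_succ, qN_mul, norm_mul, ih, pow_succ]
    congr 1
    have : qN (2 : D) = 2 * 2 := by
      rw [qN_eq, QuaternionAlgebra.re_ofNat, QuaternionAlgebra.imI_ofNat,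
        QuaternionAlgebra.imJ_ofNat, QuaternionAlgebra.imK_ofNat]
      ring
    rw [this, norm_mul, norm_two]; norm_num

/-- Reduction modulo `2^(t+6)`: if `r₀ ∈ O_D` satisfies the k-star conditions for `(a₁, t)`,
with `‖N(1 - r₀)‖ ≥ 1/4` and `‖N(z₀)‖ > 2^(-2(t+4))·‖N(a₁)‖` where
`z₀ = a₁ - r₀·a₁·(star r₀)`, then any `α ∈ O_D` congruent to `r₀` modulo `2^(t+6)·O_D`
also satisfies the k-star conditions for `(a₁, t)`. -/
theorem stmt_5 (a₁ : D) (ha₁pure : star a₁ = -a₁) (ha₁int : ‖qN a₁‖ ≤ 1)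
    (ha₁ : (1 / 2 : ℝ) ≤ ‖qN a₁‖) (t : ℕ) (ht : 1 ≤ t)
    (r₀ : D) (hr₀int : ‖qN r₀‖ ≤ 1) (hks : kStar a₁ t r₀)
    (hr₀ : (1 / 4 : ℝ) ≤ ‖qN (1 - r₀)‖)
    (hz₀ : (2 : ℝ) ^ (-(2 * ((t : ℤ) + 4))) * ‖qN a₁‖ <
      ‖qN (a₁ - r₀ * a₁ * star r₀)‖)
    (α : D) (hαint : ‖qN α‖ ≤ 1)
    (hmod : ∃ β : D, ‖qN β‖ ≤ 1 ∧ r₀ = α + 2 ^ (t + 6) * β) :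
    kStar a₁ t α := by
  obtain ⟨β, hβ, hr⟩ := hmod
  obtain ⟨h1, ⟨c, hc0, hc⟩, h3⟩ := hks
  have hα : α = r₀ - 2 ^ (t + 6) * β := by rw [hr]; simp
  obtain ⟨s, hs⟩ : ∃ s : D, s = 2 ^ (t + 6) := ⟨_, rfl⟩
  rw [← hs] at hα
  have hcomm : ∀ x : D, x * s = s * x := fun x =>
    hs ▸ ((Commute.ofNat_right x 2).pow_right (t + 6)).eq
  have hstar : star s = s := by simp [hs]
  have hNs : ‖qN s‖ = (1 / 4) ^ (t + 6) := hs ▸ qN_two_pow _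
  obtain ⟨w, hw, hw1⟩ := perturb (1 - r₀) (s * β) (by
    rw [qN_mul, norm_mul, hNs]
    have : (1 / 4 : ℝ) ^ (t + 6) ≤ (1 / 4) ^ 6 :=
      pow_le_pow_of_le_one (by norm_num) (by norm_num) (by omega)
    have : (1 / 4 : ℝ) ^ (t + 6) * ‖qN β‖ ≤ (1 / 4) ^ 6 * 1 := by gcongr
    norm_num at this
    linarith)
  have e1 : 1 - r₀ + s * β = 1 - α := by rw [hα]; abel
  rw [e1] at hw
  have hw0 : w ≠ 0 := by rintro rfl; simp at hw1
  obtain ⟨δ, hδ⟩ : ∃ δ : D, δ = β * a₁ * star r₀ + r₀ * a₁ * star β +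
    -(s * (β * a₁ * star β)) := ⟨_, rfl⟩
  have e2 : a₁ - r₀ * a₁ * star r₀ + s * δ = a₁ - α * a₁ * star α := by
    rw [hα, hδ, star_sub, star_mul, hstar, hcomm]
    have k1 : r₀ * a₁ * (s * star β) = s * (r₀ * a₁ * star β) := by
      rw [← mul_assoc, hcomm, mul_assoc]
    have k2 : s * β * a₁ * (s * star β) = s * (s * (β * a₁ * star β)) := by
      rw [← mul_assoc, hcomm]; simp only [mul_assoc]
    rw [sub_mul, sub_mul, mul_sub, mul_sub, k1, k2]
    simp only [mul_add, mul_neg, mul_assoc]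
    abel
  have hsle : ‖qN s‖ ≤ 1 := by
    rw [hNs]; exact pow_le_one₀ (by norm_num) (by norm_num)
  have hp : ∀ x y : D, ‖qN x‖ ≤ 1 → ‖qN y‖ ≤ 1 → ‖qN (x * a₁ * star y)‖ ≤ ‖qN a₁‖ := by
    intro x y hx hy
    rw [qN_mul, qN_mul, qN_star, norm_mul, norm_mul]
    calc _ ≤ 1 * ‖qN a₁‖ * 1 := by gcongr
      _ = _ := by ring
  have hδn : ‖qN δ‖ ≤ ‖qN a₁‖ := by
    rw [hδ]
    refine qN_add_le _ _ _ (qN_add_le _ _ _ (hp _ _ hβ hr₀int) (hp _ _ hr₀int hβ)) ?_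
    rw [qN_neg, qN_mul, norm_mul]
    have := mul_le_mul hsle (hp _ _ hβ hβ) (norm_nonneg _) zero_le_one
    rwa [one_mul] at this
  obtain ⟨v, hv, hv1⟩ := perturb (a₁ - r₀ * a₁ * star r₀) (s * δ) (by
    refine lt_of_le_of_lt ?_ hz₀
    rw [qN_mul, norm_mul, hNs]
    have : (2 : ℝ) ^ (-(2 * ((t : ℤ) + 4))) = (1 / 4) ^ (t + 6) * 16 := by
      rw [zpow_neg, zpow_mul, show ((t : ℤ) + 4) = ((t + 4 : ℕ) : ℤ) by push_cast; rfl,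
        zpow_natCast, pow_add, pow_add, one_div, inv_pow]
      norm_num
      ring
    rw [this]
    calc _ ≤ (1 / 4) ^ (t + 6) * ‖qN a₁‖ * 16 := by gcongr
      _ = _ := by ring)
  rw [e2] at hv
  have hv0 : v ≠ 0 := by rintro rfl; simp at hv1
  refine ⟨?_, ⟨c * v, mul_ne_zero hc0 hv0, ?_⟩, ?_⟩
  · rintro ⟨x, y, hxy⟩
    refine h1 ⟨x / w, y / w, ?_⟩
    rw [hw] at hxy
    field_simp
    linear_combination hxy
  · rw [hv]; linear_combination v ^ 2 * hc
  · rw [hv, norm_mul, norm_pow, hv1]; simpa using h3
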